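/- arXiv:2309.01466 — 2 statements merged into one kernel-verified Lean document; each statement's English description precedes it below -/
import Mathlib

section
/- Let n be an even positive natural number and let h be a natural number with 1 ≤ h ≤ n/2. Let A and B be finite sets each of size n/2, and let E ⊆ A × B be a set of pairs satisfying 12 · h · |E| ≤ n². If S is a uniformly random (h−1)-element subset of A and v is a uniformly random element of B, sampled independently, then the probability that there exists a pair (a, b) ∈ E with a ∈ S and v = b is at most 1/3. -/
open scoped ENNReal

/-- The probability of a rectangle under the independent product of two distributions. -/
theorem PMF.toOuterMeasure_bind_map_prodMk_prod {α β : Type*} (p : PMF α) (q : PMF β)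
    (s : Set α) (t : Set β) :
    (p.bind fun a => q.map fun b => (a, b)).toOuterMeasure (s ×ˢ t) =
      p.toOuterMeasure s * q.toOuterMeasure t := by
  classical
  rw [PMF.toOuterMeasure_bind_apply, PMF.toOuterMeasure_apply p, ← ENNReal.tsum_mul_right]
  refine tsum_congr fun a => ?_
  rw [PMF.toOuterMeasure_map_apply]
  by_cases ha : a ∈ s
  · rw [Set.mk_preimage_prod_right ha, Set.indicator_of_mem ha]
  · rw [Set.mk_preimage_prod_right_eq_empty ha, Set.indicator_of_notMem ha]
    simp

/-- Double counting pairs consisting of a `k`-element subset containing `a` and an element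
of `s`. -/
theorem Finset.card_mul_card_filter_mem_powersetCard {α : Type*} [DecidableEq α] {s : Finset α}
    {a : α} (ha : a ∈ s) (k : ℕ) :
    s.card * ((s.powersetCard k).filter (a ∈ ·)).card = k * (s.powersetCard k).card := by
  cases k with
  | zero => simp
  | succ k =>
    obtain ⟨m, hm⟩ := Nat.exists_eq_add_one.mpr (Finset.card_pos.mpr ⟨a, ha⟩)
    have h := Finset.card_filter_powersetCard_subset {a} s (k + 1)
      (Finset.singleton_subset_iff.mpr ha) (by simp)
    simp only [Finset.singleton_subset_iff, Finset.card_singleton] at h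
    rw [h, Finset.card_powersetCard, hm, Nat.add_sub_cancel, Nat.add_sub_cancel,
      Nat.add_one_mul_choose_eq, mul_comm]

/-- A fixed element of `s` lies in a uniformly random `k`-element subset of `s` with probability
`k / |s|`. -/
theorem PMF.toOuterMeasure_uniformOfFinset_powersetCard_mem {α : Type*} [DecidableEq α]
    {s : Finset α} {a : α} (ha : a ∈ s) (k : ℕ) (hs : (s.powersetCard k).Nonempty) :
    (PMF.uniformOfFinset (s.powersetCard k) hs).toOuterMeasure {t | a ∈ t} =
      (k : ℝ≥0∞) / s.card := by
  rw [PMF.toOuterMeasure_uniformOfFinset_apply]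
  have hs0 : (s.card : ℝ≥0∞) ≠ 0 := Nat.cast_ne_zero.mpr (Finset.card_pos.mpr ⟨a, ha⟩).ne'
  have hp0 : ((s.powersetCard k).card : ℝ≥0∞) ≠ 0 :=
    Nat.cast_ne_zero.mpr (Finset.card_pos.mpr hs).ne'
  have h : (s.card : ℝ≥0∞) * ((s.powersetCard k).filter (a ∈ ·)).card =
      k * (s.powersetCard k).card := by
    exact_mod_cast Finset.card_mul_card_filter_mem_powersetCard ha k
  rw [ENNReal.div_eq_div_iff hs0 (ENNReal.natCast_ne_top _) hp0 (ENNReal.natCast_ne_top _),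
    mul_comm _ (k : ℝ≥0∞), ← h]
  simp

/-- Quantitative core of Lemma 3.2: with `|A| = |B| = n/2`, `1 ≤ h ≤ n/2`, and a set of
pairs `E ⊆ A × B` with `12 · h · |E| ≤ n²`, if `S` is a uniformly random `(h-1)`-element
subset of `A` and `v` an independent uniformly random element of `B`, then the
probability that some pair `(a, b) ∈ E` has `a ∈ S` and `v = b` is at most `1/3`. -/
theorem prob_exists_edge_le_third
    {α β : Type*} [DecidableEq α] [DecidableEq β] (n h : ℕ)
    (hn0 : 0 < n) (hneven : Even n) (hh1 : 1 ≤ h) (hh2 : h ≤ n / 2)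
    (A : Finset α) (B : Finset β) (hA : A.card = n / 2) (hB : B.card = n / 2)
    (E : Finset (α × β)) (hEsub : E ⊆ A ×ˢ B) (hE : 12 * h * E.card ≤ n ^ 2) :
    ((PMF.uniformOfFinset (A.powersetCard (h - 1))
        (Finset.powersetCard_nonempty.mpr (by omega))).bind fun S =>
      (PMF.uniformOfFinset B (Finset.card_pos.mp (by omega))).map fun v =>
        (S, v)).toOuterMeasure
      {p : Finset α × β | ∃ e ∈ E, e.1 ∈ p.1 ∧ p.2 = e.2}
      ≤ 1 / 3 := by
  set p := PMF.uniformOfFinset (A.powersetCard (h - 1))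
    (Finset.powersetCard_nonempty.mpr (by omega)) with hp
  set q := PMF.uniformOfFinset B (Finset.card_pos.mp (by omega)) with hq
  have hset : {p : Finset α × β | ∃ e ∈ E, e.1 ∈ p.1 ∧ p.2 = e.2} =
      ⋃ e ∈ E, {S : Finset α | e.1 ∈ S} ×ˢ {e.2} := by
    ext x
    simp [and_comm]
  have hpair : ∀ e ∈ E, (p.bind fun S => q.map fun v => (S, v)).toOuterMeasure
      ({S : Finset α | e.1 ∈ S} ×ˢ {e.2}) =
        ((h - 1 : ℕ) : ℝ≥0∞) / (n / 2 : ℕ) * ((n / 2 : ℕ) : ℝ≥0∞)⁻¹ := fun e he => by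
    obtain ⟨he1, he2⟩ := Finset.mem_product.mp (hEsub he)
    rw [PMF.toOuterMeasure_bind_map_prodMk_prod, hp,
      PMF.toOuterMeasure_uniformOfFinset_powersetCard_mem he1, PMF.toOuterMeasure_apply_singleton,
      hq, PMF.uniformOfFinset_apply_of_mem _ he2, hA, hB]
  obtain ⟨m, rfl⟩ := hneven
  have hm : (m + m) / 2 = m := by omega
  have hm0 : (m : ℝ≥0∞) ≠ 0 := Nat.cast_ne_zero.mpr (by omega)
  have hcount : E.card * (h - 1) * 3 ≤ m * m := by
    have : E.card * (h - 1) ≤ E.card * h := Nat.mul_le_mul_left _ (Nat.sub_le h 1)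
    nlinarith
  have hcount' : (E.card : ℝ≥0∞) * (h - 1 : ℕ) * 3 ≤ m * m := by exact_mod_cast hcount
  rw [hset]
  refine (MeasureTheory.measure_biUnion_finset_le E _).trans ?_
  rw [Finset.sum_congr rfl hpair, Finset.sum_const, nsmul_eq_mul, hm, div_eq_mul_inv, mul_assoc,
    ← ENNReal.mul_inv (Or.inl hm0) (Or.inl (ENNReal.natCast_ne_top m)), ← mul_assoc,
    ← div_eq_mul_inv]
  refine ENNReal.div_le_of_le_mul ?_
  rwa [mul_comm (1 / 3 : ℝ≥0∞), mul_one_div, ENNReal.le_div_iff_mul_le (by simp) (by simp)]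
end

section
/- Let n be an even positive natural number and let h be a natural number with 1 ≤ h ≤ n/2. Let A and B be finite sets each of size n/2, and let E₀, E₁ ⊆ A × B be two sets of pairs, each satisfying 12 · h · |Eᵢ| ≤ n² (for i = 0, 1). If S is a uniformly random (h−1)-element subset of A and v is a uniformly random element of B, sampled independently, then with probability at least 1/3 there is no pair (a, b) ∈ E₀ ∪ E₁ with a ∈ S and v = b. -/
open scoped ENNReal

/-- Sampling independently and uniformly from two finite sets is the same as sampling
uniformly from their product. -/
theorem PMF.uniformOfFinset_bind_map_prodMk {γ δ : Type*} (s : Finset γ) (t : Finset δ)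
    (hs : s.Nonempty) (ht : t.Nonempty) :
    ((PMF.uniformOfFinset s hs).bind fun x => (PMF.uniformOfFinset t ht).map fun y => (x, y)) =
      PMF.uniformOfFinset (s ×ˢ t) (hs.product ht) := by
  classical
  ext ⟨x, y⟩
  rw [PMF.bind_apply, tsum_eq_single x]
  · rw [PMF.map_apply, tsum_eq_single y]
    · by_cases hx : x ∈ s <;> by_cases hy : y ∈ t <;>
        simp [PMF.uniformOfFinset_apply, hx, hy, ENNReal.mul_inv]
    · intro y' hy'
      simp [Ne.symm hy']
  · intro x' hx'
    simp [PMF.map_apply, Ne.symm hx']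

/-- An element of `A` lies in a fraction `k / #A` of the `k`-element subsets of `A`. -/
theorem Finset.card_filter_mem_powersetCard_mul {α : Type*} [DecidableEq α] (A : Finset α)
    {k : ℕ} (hk : k ≤ A.card) {a : α} (ha : a ∈ A) :
    ((A.powersetCard k).filter (a ∈ ·)).card * A.card = k * (A.powersetCard k).card := by
  have hcompl : (A.powersetCard k).filter (a ∉ ·) = (A.erase a).powersetCard k := by
    ext S
    simp only [Finset.mem_filter, Finset.mem_powersetCard, Finset.subset_erase]
    tauto
  have hsplit := Finset.card_filter_add_card_filter_not (s := A.powersetCard k) (a ∈ ·)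
  rw [hcompl, Finset.card_powersetCard, Finset.card_powersetCard,
    Finset.card_erase_of_mem ha] at hsplit
  rw [Finset.card_powersetCard]
  obtain ⟨m, hm⟩ : ∃ m, A.card = m + 1 :=
    Nat.exists_eq_add_one.mpr (Finset.card_pos.mpr ⟨a, ha⟩)
  rw [hm] at hsplit hk ⊢
  have hchoose := Nat.choose_mul_succ_eq m k
  simp only [Nat.add_sub_cancel] at hsplit
  zify [hk] at hsplit hchoose ⊢
  linear_combination (m + 1 : ℤ) * hsplit - hchoose

/-- Union bound, in counting form, on the pairs `(S, v)` which some pair of `E` connects. -/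
theorem Finset.card_filter_exists_mem_powersetCard_mul_le {α β : Type*} [DecidableEq α]
    [DecidableEq β] (A : Finset α) (B : Finset β) {k : ℕ} (hk : k ≤ A.card)
    (E : Finset (α × β)) (hE : E ⊆ A ×ˢ B) :
    ((A.powersetCard k ×ˢ B).filter fun p => ∃ e ∈ E, e.1 ∈ p.1 ∧ p.2 = e.2).card * A.card ≤
      E.card * (k * (A.powersetCard k).card) := by
  have hsub : ((A.powersetCard k ×ˢ B).filter fun p => ∃ e ∈ E, e.1 ∈ p.1 ∧ p.2 = e.2) ⊆
      E.biUnion fun e => (A.powersetCard k).filter (e.1 ∈ ·) ×ˢ {e.2} := by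
    rintro ⟨S, v⟩ hp
    simp only [Finset.mem_filter, Finset.mem_product] at hp
    obtain ⟨⟨hS, -⟩, e, he, heS, hv⟩ := hp
    simp only [Finset.mem_biUnion, Finset.mem_product, Finset.mem_filter, Finset.mem_singleton]
    exact ⟨e, he, ⟨hS, heS⟩, hv⟩
  calc _ ≤ (∑ e ∈ E, ((A.powersetCard k).filter (e.1 ∈ ·)).card) * A.card := by
        gcongr
        refine (Finset.card_le_card hsub).trans (Finset.card_biUnion_le.trans_eq ?_)
        simp
    _ = ∑ e ∈ E, k * (A.powersetCard k).card := by
        rw [Finset.sum_mul]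
        exact Finset.sum_congr rfl fun e he =>
          A.card_filter_mem_powersetCard_mul hk (Finset.mem_product.mp (hE he)).1
    _ = _ := by rw [Finset.sum_const, smul_eq_mul]

/-- Combinatorial skeleton of Lemma 3.2: with `|A| = |B| = n/2`, `1 ≤ h ≤ n/2`, and two
sets of pairs `E₀, E₁ ⊆ A × B` each with `12 · h · |Eᵢ| ≤ n²`, if `S` is a uniformly
random `(h-1)`-element subset of `A` and `v` an independent uniformly random element of
`B`, then with probability at least `1/3` no pair `(a, b) ∈ E₀ ∪ E₁` has `a ∈ S` and
`v = b`. -/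
theorem prob_disconnected_ge_third
    {α β : Type*} [DecidableEq α] [DecidableEq β] (n h : ℕ)
    (hn0 : 0 < n) (hneven : Even n) (hh1 : 1 ≤ h) (hh2 : h ≤ n / 2)
    (A : Finset α) (B : Finset β) (hA : A.card = n / 2) (hB : B.card = n / 2)
    (E₀ E₁ : Finset (α × β)) (hE₀sub : E₀ ⊆ A ×ˢ B) (hE₁sub : E₁ ⊆ A ×ˢ B)
    (hE₀ : 12 * h * E₀.card ≤ n ^ 2) (hE₁ : 12 * h * E₁.card ≤ n ^ 2) :
    1 / 3 ≤
    ((PMF.uniformOfFinset (A.powersetCard (h - 1))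
        (Finset.powersetCard_nonempty.mpr (by omega))).bind fun S =>
      (PMF.uniformOfFinset B (Finset.card_pos.mp (by omega))).map fun v =>
        (S, v)).toOuterMeasure
      {p : Finset α × β | ¬ ∃ e ∈ E₀ ∪ E₁, e.1 ∈ p.1 ∧ p.2 = e.2} := by
  rw [PMF.uniformOfFinset_bind_map_prodMk, PMF.toOuterMeasure_uniformOfFinset_apply]
  have hP : 0 < (A.powersetCard (h - 1)).card :=
    Finset.card_pos.mpr (Finset.powersetCard_nonempty.mpr (by omega))
  have hbad := Finset.card_filter_exists_mem_powersetCard_mul_le A B (k := h - 1) (by omega)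
    (E₀ ∪ E₁) (Finset.union_subset hE₀sub hE₁sub)
  have hsplit := Finset.card_filter_add_card_filter_not (s := A.powersetCard (h - 1) ×ˢ B)
    (fun p => ∃ e ∈ E₀ ∪ E₁, e.1 ∈ p.1 ∧ p.2 = e.2)
  have hE := Finset.card_union_le E₀ E₁
  obtain ⟨m, rfl⟩ := hneven
  obtain ⟨k, rfl⟩ := Nat.exists_eq_add_of_le' hh1
  have hm : (m + m) / 2 = m := by omega
  rw [hm] at hA hB
  simp only [Nat.add_sub_cancel, Set.mem_ofPred_eq] at hbad hsplit hP ⊢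
  have hcard : (A.powersetCard k ×ˢ B).card = (A.powersetCard k).card * m := by
    rw [Finset.card_product, hB]
  have hcount : (A.powersetCard k ×ˢ B).card ≤ 3 * ((A.powersetCard k ×ˢ B).filter
      fun p => ¬ ∃ e ∈ E₀ ∪ E₁, e.1 ∈ p.1 ∧ p.2 = e.2).card := by
    rw [hcard] at hsplit ⊢
    rw [hA] at hbad
    have hEk : 3 * ((E₀ ∪ E₁).card * k) ≤ 2 * m ^ 2 := by nlinarith
    have hEkP := Nat.mul_le_mul_right (A.powersetCard k).card hEk
    have hbad_le : 3 * ((A.powersetCard k ×ˢ B).filter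
        fun p => ∃ e ∈ E₀ ∪ E₁, e.1 ∈ p.1 ∧ p.2 = e.2).card ≤
          2 * ((A.powersetCard k).card * m) := by
      refine le_of_mul_le_mul_right ?_ (show 0 < m by omega)
      linarith
    omega
  have hpos : 0 < (A.powersetCard k ×ˢ B).card := by
    rw [hcard]; exact Nat.mul_pos hP (by omega)
  rw [ENNReal.div_le_iff (by simp) (by simp), mul_comm, ← mul_div_assoc,
    ENNReal.le_div_iff_mul_le (Or.inl (by exact_mod_cast hpos.ne'))
      (Or.inl (ENNReal.natCast_ne_top _)), one_mul]
  exact_mod_cast hcount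
end
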